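/- arXiv:2103.01111 — 2 statements merged into one kernel-verified Lean document; each statement's English description precedes it below -/
import Mathlib

section
/- Let τ be a density matrix on H_A ⊗ H_B with H_A, H_B finite-dimensional, with reduced density matrices τ_A and τ_B. Then the range of τ is contained in the range of τ_A ⊗ τ_B. -/
open Matrix Finset ComplexOrder Kronecker

/-- Von Neumann entropy (base 2) of a (Hermitian) matrix, via its eigenvalues;
`0` if the matrix is not Hermitian. The convention `0 · log₂ 0 = 0` is automatic. -/
noncomputable def vNEntropy {n : Type*} [Fintype n] [DecidableEq n] (M : Matrix n n ℂ) : ℝ :=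
  if h : M.IsHermitian then ∑ i, -(h.eigenvalues i * Real.logb 2 (h.eigenvalues i)) else 0

/-- Partial trace over the second tensor factor: `τ ↦ τ_A`. -/
noncomputable def ptraceB {A B : Type*} [Fintype B]
    (τ : Matrix (A × B) (A × B) ℂ) : Matrix A A ℂ :=
  fun x y => ∑ b : B, τ (x, b) (y, b)

/-- Partial trace over the first tensor factor: `τ ↦ τ_B`. -/
noncomputable def ptraceA {A B : Type*} [Fintype A]
    (τ : Matrix (A × B) (A × B) ℂ) : Matrix B B ℂ :=
  fun x y => ∑ a : A, τ (a, x) (a, y)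

theorem exists_ginv {n : Type*} [Fintype n] [DecidableEq n] (N : Matrix n n ℂ) :
    ∃ Y : Matrix n n ℂ, N * Y * N = N := by
  obtain ⟨s, hs⟩ := LinearMap.exists_rightInverse_of_surjective
    (Matrix.toLin' N).rangeRestrict (LinearMap.range_rangeRestrict _)
  obtain ⟨g, hg⟩ := LinearMap.exists_extend s
  refine ⟨LinearMap.toMatrix' g, ?_⟩
  apply Matrix.toLin'.injective
  rw [Matrix.toLin'_mul, Matrix.toLin'_mul, Matrix.toLin'_toMatrix']
  ext1 i
  ext1
  have h1 := LinearMap.congr_fun hg ((Matrix.toLin' N).rangeRestrict (Pi.single i 1))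
  have h2 := LinearMap.congr_fun hs ((Matrix.toLin' N).rangeRestrict (Pi.single i 1))
  rw [LinearMap.comp_apply, ← h1] at h2
  have h3 := congrArg Subtype.val h2
  simpa using h3

theorem ptraceB_annihil {A B : Type*} [Fintype A] [Fintype B] [DecidableEq A] [DecidableEq B]
    (C : Matrix (A × B) (A × B) ℂ) (W : Matrix A A ℂ)
    (h : W * ptraceB (C * Cᴴ) = 0) : (W ⊗ₖ (1 : Matrix B B ℂ)) * C = 0 := by
  let M : Matrix A (B × (A × B)) ℂ := Matrix.of fun a p => C (a, p.1) p.2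
  have hM : ptraceB (C * Cᴴ) = M * Mᴴ := by
    ext x y
    simp only [ptraceB, Matrix.mul_apply, Matrix.conjTranspose_apply, M,
      Fintype.sum_prod_type, Matrix.of_apply]
  rw [hM, Matrix.mul_self_mul_conjTranspose_eq_zero] at h
  ext ⟨a, b⟩ k
  have := congrFun (congrFun h a) (b, k)
  simpa [Matrix.mul_apply, Fintype.sum_prod_type, Matrix.one_apply, M] using this

theorem ptraceA_annihil {A B : Type*} [Fintype A] [Fintype B] [DecidableEq A] [DecidableEq B]
    (C : Matrix (A × B) (A × B) ℂ) (W : Matrix B B ℂ)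
    (h : W * ptraceA (C * Cᴴ) = 0) : ((1 : Matrix A A ℂ) ⊗ₖ W) * C = 0 := by
  let M : Matrix B (A × (A × B)) ℂ := Matrix.of fun b p => C (p.1, b) p.2
  have hM : ptraceA (C * Cᴴ) = M * Mᴴ := by
    ext x y
    simp only [ptraceA, Matrix.mul_apply, Matrix.conjTranspose_apply, M,
      Fintype.sum_prod_type, Matrix.of_apply]
  rw [hM, Matrix.mul_self_mul_conjTranspose_eq_zero] at h
  ext ⟨a, b⟩ k
  have := congrFun (congrFun h b) (a, k)
  rw [Matrix.mul_apply, Fintype.sum_prod_type_right]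
  simpa [Matrix.mul_apply, Matrix.one_apply, M] using this

theorem stmt11 {A B : Type*} [Fintype A] [Fintype B] [DecidableEq A] [DecidableEq B]
    (τ : Matrix (A × B) (A × B) ℂ) (hτ : τ.PosSemidef) (htr : τ.trace = 1) :
    LinearMap.range τ.mulVecLin ≤
      LinearMap.range (ptraceB τ ⊗ₖ ptraceA τ).mulVecLin := by
  obtain ⟨D, hD⟩ : ∃ D : Matrix (A × B) (A × B) ℂ, τ = Dᴴ * D := by
    open scoped MatrixOrder in
    exact CStarAlgebra.nonneg_iff_eq_star_mul_self.mp hτ.nonneg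
  obtain ⟨C, hC⟩ : ∃ C : Matrix (A × B) (A × B) ℂ, τ = C * Cᴴ := ⟨Dᴴ, by simpa using hD⟩
  obtain ⟨Y, hY⟩ := exists_ginv (ptraceB τ)
  obtain ⟨Z, hZ⟩ := exists_ginv (ptraceA τ)
  have h1 := ptraceB_annihil C (ptraceB τ * Y - 1) (by rw [← hC, sub_mul, hY, one_mul, sub_self])
  have h2 := ptraceA_annihil C (ptraceA τ * Z - 1) (by rw [← hC, sub_mul, hZ, one_mul, sub_self])
  have e1 : (ptraceB τ * Y - 1) ⊗ₖ (1 : Matrix B B ℂ)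
      = (ptraceB τ * Y) ⊗ₖ (1 : Matrix B B ℂ) - (1 : Matrix A A ℂ) ⊗ₖ (1 : Matrix B B ℂ) := by
    ext x y
    simp only [Matrix.kroneckerMap_apply, Matrix.sub_apply, sub_mul]
  have e2 : (1 : Matrix A A ℂ) ⊗ₖ (ptraceA τ * Z - 1)
      = (1 : Matrix A A ℂ) ⊗ₖ (ptraceA τ * Z) - (1 : Matrix A A ℂ) ⊗ₖ (1 : Matrix B B ℂ) := by
    ext x y
    simp only [Matrix.kroneckerMap_apply, Matrix.sub_apply, mul_sub]
  rw [e1, sub_mul, Matrix.one_kronecker_one, one_mul, sub_eq_zero] at h1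
  rw [e2, sub_mul, Matrix.one_kronecker_one, one_mul, sub_eq_zero] at h2
  have h3 : (ptraceB τ ⊗ₖ ptraceA τ) * ((Y ⊗ₖ Z) * τ) = τ := by
    rw [← mul_assoc, ← Matrix.mul_kronecker_mul]
    have : (ptraceB τ * Y) ⊗ₖ (ptraceA τ * Z)
        = ((ptraceB τ * Y) ⊗ₖ (1 : Matrix B B ℂ)) * ((1 : Matrix A A ℂ) ⊗ₖ (ptraceA τ * Z)) := by
      rw [← Matrix.mul_kronecker_mul, mul_one, one_mul]
    rw [this]
    have h4 : ((ptraceB τ * Y) ⊗ₖ (1 : Matrix B B ℂ)) * ((1 : Matrix A A ℂ) ⊗ₖ (ptraceA τ * Z))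
        * (C * Cᴴ) = C * Cᴴ := by
      rw [← mul_assoc, mul_assoc _ _ C, h2, h1]
    rwa [← hC] at h4
  rintro _ ⟨v, rfl⟩
  refine ⟨((Y ⊗ₖ Z) * τ) *ᵥ v, ?_⟩
  rw [Matrix.mulVecLin_apply, Matrix.mulVecLin_apply, Matrix.mulVec_mulVec, h3]
end

section
/- Let τ be a density matrix on H_A ⊗ H_B with H_A, H_B finite-dimensional, with reduced density matrices τ_A and τ_B. Then rank(τ) ≤ rank(τ_A) · rank(τ_B); equivalently, the Hartley entropies satisfy S⁰(τ) ≤ S⁰(τ_A) + S⁰(τ_B), where S⁰(ρ) = log₂ rank(ρ). -/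
open Matrix Finset ComplexOrder Kronecker

theorem exists_rank_factor {A K : Type*} [Fintype A] [DecidableEq A] [Fintype K] [DecidableEq K]
    (X : Matrix A K ℂ) :
    ∃ (C : Matrix A (Fin X.rank) ℂ) (L : Matrix (Fin X.rank) A ℂ), C * (L * X) = X := by
  let S := LinearMap.range X.mulVecLin
  let e : S ≃ₗ[ℂ] (Fin X.rank → ℂ) :=
    LinearEquiv.ofFinrankEq _ _ (by rw [Module.finrank_fin_fun]; rfl)
  obtain ⟨p, hp⟩ := LinearMap.exists_leftInverse_of_injective S.subtype (Submodule.ker_subtype S)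
  refine ⟨LinearMap.toMatrix' (S.subtype ∘ₗ e.symm.toLinearMap),
    LinearMap.toMatrix' (e.toLinearMap ∘ₗ p), ?_⟩
  apply Matrix.toLin'.injective
  rw [Matrix.toLin'_mul, Matrix.toLin'_mul, Matrix.toLin'_toMatrix', Matrix.toLin'_toMatrix']
  ext1 k
  have h : ∀ v, p (X.mulVec v) = ⟨X.mulVec v, ⟨v, rfl⟩⟩ := fun v =>
    LinearMap.congr_fun hp (⟨X.mulVec v, ⟨v, rfl⟩⟩ : S)
  ext1
  simp [-Matrix.mulVec_single, h]

theorem fix_of_fix_mul_conjTranspose {A K R : Type*} [Fintype A] [DecidableEq A] [Fintype K]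
    [Fintype R]
    (X : Matrix A K ℂ) (C : Matrix A R ℂ) (L : Matrix R A ℂ)
    (h : C * (L * (X * Xᴴ)) = X * Xᴴ) : (C * L) * X = X := by
  have h1 : (C * L - 1) * (X * Xᴴ) = 0 := by
    rw [Matrix.sub_mul, Matrix.mul_assoc, h, Matrix.one_mul, sub_self]
  rw [Matrix.mul_self_mul_conjTranspose_eq_zero, Matrix.sub_mul, Matrix.one_mul, sub_eq_zero] at h1
  exact h1

open scoped MatrixOrder Matrix.Norms.L2Operator in
theorem exists_sqrt_aux {n : Type*} [Fintype n] [DecidableEq n] (τ : Matrix n n ℂ)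
    (hτ : τ.PosSemidef) : ∃ M : Matrix n n ℂ, τ = M * Mᴴ := by
  obtain ⟨y, hy⟩ := CStarAlgebra.nonneg_iff_eq_star_mul_self.mp hτ.nonneg
  exact ⟨yᴴ, by rw [hy, Matrix.conjTranspose_conjTranspose, Matrix.star_eq_conjTranspose]⟩

theorem rank_le_aux {A B : Type*} [Fintype A] [Fintype B] [DecidableEq A] [DecidableEq B]
    (τ : Matrix (A × B) (A × B) ℂ) (hτ : τ.PosSemidef) :
    τ.rank ≤ (ptraceB τ).rank * (ptraceA τ).rank := by
  obtain ⟨M, hM⟩ : ∃ M : Matrix (A × B) (A × B) ℂ, τ = M * Mᴴ :=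
    exists_sqrt_aux τ hτ
  let X : Matrix A (B × (A × B)) ℂ := fun a q => M (a, q.1) q.2
  let Y : Matrix B (A × (A × B)) ℂ := fun b q => M (q.1, b) q.2
  have hX : ptraceB τ = X * Xᴴ := by
    ext x y
    rw [Matrix.mul_apply, Fintype.sum_prod_type]
    simp only [ptraceB, hM, Matrix.mul_apply]
    rfl
  have hY : ptraceA τ = Y * Yᴴ := by
    ext x y
    rw [Matrix.mul_apply, Fintype.sum_prod_type]
    simp only [ptraceA, hM, Matrix.mul_apply]
    rfl
  obtain ⟨C, L, hC⟩ := exists_rank_factor (ptraceB τ)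
  obtain ⟨E, F, hE⟩ := exists_rank_factor (ptraceA τ)
  have hCX : (C * L) * X = X := fix_of_fix_mul_conjTranspose X C L (by rw [← hX]; exact hC)
  have hEY : (E * F) * Y = Y := fix_of_fix_mul_conjTranspose Y E F (by rw [← hY]; exact hE)
  have hN : ((C * L) ⊗ₖ (E * F)) * M = M := by
    ext ⟨a, b⟩ k
    have h1 : ∀ a2, ∑ b2, (E * F) b b2 * M (a2, b2) k = M (a2, b) k := fun a2 => by
      have := congrFun (congrFun hEY b) (a2, k)
      rwa [Matrix.mul_apply] at this
    have h2 : ∑ a2, (C * L) a a2 * M (a2, b) k = M (a, b) k := by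
      have := congrFun (congrFun hCX a) (b, k)
      rwa [Matrix.mul_apply] at this
    rw [Matrix.mul_apply, Fintype.sum_prod_type, ← h2]
    refine Finset.sum_congr rfl fun a2 _ => ?_
    rw [← h1 a2, Finset.mul_sum]
    refine Finset.sum_congr rfl fun b2 _ => ?_
    rw [Matrix.kroneckerMap_apply, mul_assoc]
  have hτ2 : τ = (C ⊗ₖ E) * ((L ⊗ₖ F) * M * Mᴴ) := by
    rw [Matrix.mul_kronecker_mul] at hN
    rw [← Matrix.mul_assoc, ← Matrix.mul_assoc, hN, ← hM]
  have h3 : τ.rank ≤ (C ⊗ₖ E).rank := by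
    conv_lhs => rw [hτ2]
    exact Matrix.rank_mul_le_left _ _
  refine h3.trans ((Matrix.rank_le_card_width _).trans ?_)
  simp

theorem stmt12 {A B : Type*} [Fintype A] [Fintype B] [DecidableEq A] [DecidableEq B]
    (τ : Matrix (A × B) (A × B) ℂ) (hτ : τ.PosSemidef) (htr : τ.trace = 1) :
    τ.rank ≤ (ptraceB τ).rank * (ptraceA τ).rank ∧
      Real.logb 2 τ.rank ≤
        Real.logb 2 (ptraceB τ).rank + Real.logb 2 (ptraceA τ).rank := by
  have h := rank_le_aux τ hτ
  have h0 : 0 < τ.rank := by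
    rw [Nat.pos_iff_ne_zero]
    intro h0
    obtain ⟨C, L, hC⟩ := exists_rank_factor τ
    have hz : τ = 0 := by
      have : IsEmpty (Fin τ.rank) := by rw [h0]; infer_instance
      rw [← hC]
      ext i j
      simp [Matrix.mul_apply]
    simp [hz] at htr
  refine ⟨h, ?_⟩
  have hA : (ptraceB τ).rank ≠ 0 := by
    intro hh
    rw [hh] at h
    omega
  have hB : (ptraceA τ).rank ≠ 0 := by
    intro hh
    rw [hh] at h
    omega
  rw [← Real.logb_mul (Nat.cast_ne_zero.mpr hA) (Nat.cast_ne_zero.mpr hB)]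
  exact Real.logb_le_logb_of_le (by norm_num) (by exact_mod_cast h0) (by exact_mod_cast h)
end
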